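/- Let N = 2, q ∈ ℂ*, and ξ = diag(ξ₁, ξ₂) a diagonal ℂ-point of M_q. Define ψ^ξ = π∘β^ξ : O(M_q) → O(SL_q) and φ^ξ = π∘α^ξ : O(M_q) → O(SL_q). Then for every n ≥ 1: ψ^ξ(x_{21}^n) = (−q)^n (ξ₁ − ξ₂)(ξ₁ − q²ξ₂)⋯(ξ₁ − q^{2n−2}ξ₂) c^n a^n, and φ^ξ(x_{21}^n) = (−q)^n (ξ₁ − q^{-2}ξ₂)(ξ₁ − q^{-4}ξ₂)⋯(ξ₁ − q^{-2n}ξ₂) a^n c^n. -/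

import Mathlib

open TensorProduct

noncomputable section

/-- Number of inversions (the length) of a permutation of `Fin t`. -/
def invCount {t : ℕ} (σ : Equiv.Perm (Fin t)) : ℕ :=
  (Finset.univ.filter fun p : Fin t × Fin t => p.1 < p.2 ∧ σ p.2 < σ p.1).card

/-- The principal quantum minor `[I|I]` of the matrix of generators `x`. -/
def qMinor {A : Type} [CommRing A] {M : Type} [Ring M] [Algebra A M] {N : ℕ}
    (q : A) (x : Fin N → Fin N → M) (I : Finset (Fin N)) : M :=
  ∑ σ : Equiv.Perm (Fin I.card),
    ((-q) ^ invCount σ) •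
      ((List.finRange I.card).map fun k =>
        x ((I.orderIsoOfFin rfl) k).1 ((I.orderIsoOfFin rfl) (σ k)).1).prod

/-- The quantum determinant. -/
def qdet {A : Type} [CommRing A] {M : Type} [Ring M] [Algebra A M] {N : ℕ}
    (q : A) (x : Fin N → Fin N → M) : M :=
  qMinor q x Finset.univ

/-- `w(I)`: the sum of the elements of `I` (with `{1, …, N}` indexing). -/
def wtSet {N : ℕ} (I : Finset (Fin N)) : ℕ := ∑ j ∈ I, (j.1 + 1)

/-- The weighted sum `τ_i` of principal quantum minors of size `i`. -/
def tauCoinv {A : Type} [CommRing A] {M : Type} [Ring M] [Algebra A M] {N : ℕ}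
    (q qinv : A) (x : Fin N → Fin N → M) (i : ℕ) : M :=
  ∑ I ∈ Finset.univ.filter (fun I : Finset (Fin N) => I.card = i),
    qinv ^ (2 * wtSet I) • qMinor q x I

/-- The sum `σ_i` of all principal quantum minors of size `i`. -/
def sigmaCoinv {A : Type} [CommRing A] {M : Type} [Ring M] [Algebra A M] {N : ℕ}
    (q : A) (x : Fin N → Fin N → M) (i : ℕ) : M :=
  ∑ I ∈ Finset.univ.filter (fun I : Finset (Fin N) => I.card = i), qMinor q x I

/-- The right adjoint coaction `β(h) = Σ h₂ ⊗ S(h₁)h₃`. -/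
def adjBeta {A : Type} [CommRing A] {M G : Type} [Ring M] [Algebra A M] [Ring G] [Algebra A G]
    (ΔM : M →ₐ[A] M ⊗[A] M) (ι : M →ₐ[A] G) (St : G →ₗ[A] G) : M →ₗ[A] M ⊗[A] G :=
  TensorProduct.map LinearMap.id (LinearMap.mul' A G) ∘ₗ
  (TensorProduct.assoc A M G G).toLinearMap ∘ₗ
  TensorProduct.map
    ((TensorProduct.comm A G M).toLinearMap ∘ₗ
      TensorProduct.map (St ∘ₗ ι.toLinearMap) LinearMap.id)
    ι.toLinearMap ∘ₗ
  TensorProduct.map ΔM.toLinearMap LinearMap.id ∘ₗ ΔM.toLinearMap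

/-- The right coaction `α(h) = Σ h₂ ⊗ h₃S(h₁)`. -/
def adjAlpha {A : Type} [CommRing A] {M G : Type} [Ring M] [Algebra A M] [Ring G] [Algebra A G]
    (ΔM : M →ₐ[A] M ⊗[A] M) (ι : M →ₐ[A] G) (St : G →ₗ[A] G) : M →ₗ[A] M ⊗[A] G :=
  TensorProduct.map LinearMap.id (LinearMap.mul' A G) ∘ₗ
  TensorProduct.map LinearMap.id (TensorProduct.comm A G G).toLinearMap ∘ₗ
  (TensorProduct.assoc A M G G).toLinearMap ∘ₗ
  TensorProduct.map
    ((TensorProduct.comm A G M).toLinearMap ∘ₗ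
      TensorProduct.map (St ∘ₗ ι.toLinearMap) LinearMap.id)
    ι.toLinearMap ∘ₗ
  TensorProduct.map ΔM.toLinearMap LinearMap.id ∘ₗ ΔM.toLinearMap

/-- The co-orbit map associated to a point `e = ev_ξ` and a coaction `b`. -/
def coorbit {A : Type} [CommRing A] {M G : Type} [Ring M] [Algebra A M] [Ring G] [Algebra A G]
    (e : M →ₐ[A] A) (b : M →ₗ[A] M ⊗[A] G) : M →ₗ[A] G :=
  (TensorProduct.lid A G).toLinearMap ∘ₗ TensorProduct.map e.toLinearMap LinearMap.id ∘ₗ b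

/-- The left coaction `λ_D = (π_D ⊗ id) ∘ Δ` of a quotient Hopf algebra. -/
def leftCoact {A : Type} [CommRing A] {G D : Type} [Ring G] [Algebra A G]
    [CommRing D] [Algebra A D]
    (πD : G →ₐ[A] D) (ΔG : G →ₐ[A] G ⊗[A] G) : G →ₗ[A] D ⊗[A] G :=
  TensorProduct.map πD.toLinearMap LinearMap.id ∘ₗ ΔG.toLinearMap

/-- Coinvariants of the left coaction `λ_D`. -/
def dCoinv {A : Type} [CommRing A] {G D : Type} [Ring G] [Algebra A G]
    [CommRing D] [Algebra A D]
    (πD : G →ₐ[A] D) (ΔG : G →ₐ[A] G ⊗[A] G) : Set G :=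
  {f : G | leftCoact πD ΔG f = (1 : D) ⊗ₜ[A] f}

/-- The right coaction `ρ_D = (id ⊗ π_D) ∘ Δ`. -/
def rightCoact {A : Type} [CommRing A] {G D : Type} [Ring G] [Algebra A G]
    [CommRing D] [Algebra A D]
    (πD : G →ₐ[A] D) (ΔG : G →ₐ[A] G ⊗[A] G) : G →ₗ[A] G ⊗[A] D :=
  TensorProduct.map LinearMap.id πD.toLinearMap ∘ₗ ΔG.toLinearMap

/-- The weight space of weight `ta : D` for the grading induced by `ρ_D`. -/
def weightSpace' {A : Type} [CommRing A] {G D : Type} [Ring G] [Algebra A G]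
    [CommRing D] [Algebra A D]
    (πD : G →ₐ[A] D) (ΔG : G →ₐ[A] G ⊗[A] G) (ta : D) : Submodule A G :=
  LinearMap.ker (rightCoact πD ΔG - (TensorProduct.mk A G D).flip ta)

/-- The subcomodule generated by a subset `s` of the comodule `(M, b)`. -/
def comodGen {A : Type} [CommRing A] {M G : Type} [Ring M] [Algebra A M] [Ring G] [Algebra A G]
    (b : M →ₗ[A] M ⊗[A] G) (s : Set M) : Submodule A M :=
  sInf {W : Submodule A M | s ⊆ W ∧
    ∀ w ∈ W, b w ∈ LinearMap.range (TensorProduct.map W.subtype (LinearMap.id : G →ₗ[A] G))}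

lemma qdet_fin_two {A : Type} [CommRing A] {M : Type} [Ring M] [Algebra A M]
    (q : A) (x : Fin 2 → Fin 2 → M) :
    qdet q x = x 0 0 * x 1 1 - q • (x 0 1 * x 1 0) := by
  have key : ∀ f : Fin 2 ≃o (Finset.univ : Finset (Fin 2)),
      (f 0).1 = 0 ∧ (f 1).1 = 1 := by
    intro f
    have h : (f 0).1 < (f 1).1 := f.strictMono (by decide)
    omega
  have h := key ((Finset.univ : Finset (Fin 2)).orderIsoOfFin rfl)
  have h1 : invCount (1 : Equiv.Perm (Fin 2)) = 0 := by decide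
  have h2 : invCount (Equiv.swap (0 : Fin 2) 1) = 1 := by decide
  have hu : (Finset.univ : Finset (Equiv.Perm (Fin 2))) = {1, Equiv.swap 0 1} := by decide
  change ∑ σ : Equiv.Perm (Fin 2), ((-q) ^ invCount σ) •
      ((List.finRange 2).map fun k =>
        x (((Finset.univ : Finset (Fin 2)).orderIsoOfFin rfl : Fin 2 ≃o _) k).1
          (((Finset.univ : Finset (Fin 2)).orderIsoOfFin rfl : Fin 2 ≃o _) (σ k)).1).prod = _
  rw [hu, Finset.sum_pair (by decide), h1, h2]
  simp [List.finRange_succ, h.1, h.2, sub_eq_add_neg]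

/-- A two-sided convolution inverse of the identity of a bialgebra reverses products. -/
lemma convInverse_mul_rev {A G : Type} [CommRing A] [Ring G] [Algebra A G]
    (Δ : G →ₐ[A] G ⊗[A] G) (ε : G →ₐ[A] A) (S : G →ₗ[A] G)
    (hcoassoc : (Algebra.TensorProduct.assoc A A A G G G).toAlgHom.comp
      ((Algebra.TensorProduct.map Δ (.id A G)).comp Δ)
      = (Algebra.TensorProduct.map (.id A G) Δ).comp Δ)
    (hl : (Algebra.TensorProduct.map ε (.id A G)).comp Δ
      = (Algebra.TensorProduct.lid A G).symm)
    (hr : (Algebra.TensorProduct.map (.id A G) ε).comp Δ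
      = (Algebra.TensorProduct.rid A A G).symm)
    (hS1 : LinearMap.mul' A G ∘ₗ TensorProduct.map S LinearMap.id ∘ₗ Δ.toLinearMap
      = Algebra.linearMap A G ∘ₗ ε.toLinearMap)
    (hS2 : LinearMap.mul' A G ∘ₗ TensorProduct.map LinearMap.id S ∘ₗ Δ.toLinearMap
      = Algebra.linearMap A G ∘ₗ ε.toLinearMap) :
    S 1 = 1 ∧ ∀ a b, S (a * b) = S b * S a := by
  let _ : Bialgebra A G := Bialgebra.ofAlgHom Δ ε hcoassoc hl hr
  let _ : HopfAlgebra A G :=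
    { antipode := S
      mul_antipode_rTensor_comul := hS1
      mul_antipode_lTensor_comul := hS2 }
  exact ⟨HopfAlgebra.antipode_one (R := A) (A := G),
    fun a b => HopfAlgebra.antipode_mul_antidistrib (R := A) a b⟩

/-- The linear map `h₁ ⊗ h₂ ⊗ h₃ ↦ e(h₂) π(S(h₁)h₃)`. -/
def coorbitBetaAux {A : Type} [CommRing A] {M G H : Type} [Ring M] [Algebra A M]
    [Ring G] [Algebra A G] [Ring H] [Algebra A H]
    (ι : M →ₐ[A] G) (St : G →ₗ[A] G) (e : M →ₐ[A] A) (π : G →ₐ[A] H) :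
    (M ⊗[A] M) ⊗[A] M →ₗ[A] H :=
  π.toLinearMap ∘ₗ (TensorProduct.lid A G).toLinearMap ∘ₗ
  TensorProduct.map e.toLinearMap LinearMap.id ∘ₗ
  TensorProduct.map LinearMap.id (LinearMap.mul' A G) ∘ₗ
  (TensorProduct.assoc A M G G).toLinearMap ∘ₗ
  TensorProduct.map
    ((TensorProduct.comm A G M).toLinearMap ∘ₗ
      TensorProduct.map (St ∘ₗ ι.toLinearMap) LinearMap.id)
    ι.toLinearMap

/-- The linear map `h₁ ⊗ h₂ ⊗ h₃ ↦ e(h₂) π(h₃S(h₁))`. -/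
def coorbitAlphaAux {A : Type} [CommRing A] {M G H : Type} [Ring M] [Algebra A M]
    [Ring G] [Algebra A G] [Ring H] [Algebra A H]
    (ι : M →ₐ[A] G) (St : G →ₗ[A] G) (e : M →ₐ[A] A) (π : G →ₐ[A] H) :
    (M ⊗[A] M) ⊗[A] M →ₗ[A] H :=
  π.toLinearMap ∘ₗ (TensorProduct.lid A G).toLinearMap ∘ₗ
  TensorProduct.map e.toLinearMap LinearMap.id ∘ₗ
  TensorProduct.map LinearMap.id (LinearMap.mul' A G) ∘ₗ
  TensorProduct.map LinearMap.id (TensorProduct.comm A G G).toLinearMap ∘ₗ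
  (TensorProduct.assoc A M G G).toLinearMap ∘ₗ
  TensorProduct.map
    ((TensorProduct.comm A G M).toLinearMap ∘ₗ
      TensorProduct.map (St ∘ₗ ι.toLinearMap) LinearMap.id)
    ι.toLinearMap

section

variable {A : Type} [CommRing A] {M G H : Type} [Ring M] [Algebra A M]
  [Ring G] [Algebra A G] [Ring H] [Algebra A H]
  (ι : M →ₐ[A] G) (St : G →ₗ[A] G) (e : M →ₐ[A] A) (π : G →ₐ[A] H)

lemma coorbitBetaAux_tmul (h₁ h₂ h₃ : M) :
    coorbitBetaAux ι St e π ((h₁ ⊗ₜ h₂) ⊗ₜ h₃)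
      = e h₂ • (π (St (ι h₁)) * π (ι h₃)) := by
  simp [coorbitBetaAux]

lemma coorbitAlphaAux_tmul (h₁ h₂ h₃ : M) :
    coorbitAlphaAux ι St e π ((h₁ ⊗ₜ h₂) ⊗ₜ h₃)
      = e h₂ • (π (ι h₃) * π (St (ι h₁))) := by
  simp [coorbitAlphaAux]

lemma coorbitBetaAux_mul_tmul (hmul : ∀ a b, St (a * b) = St b * St a)
    (U : (M ⊗[A] M) ⊗[A] M) (k₁ k₂ k₃ : M) :
    coorbitBetaAux ι St e π (U * ((k₁ ⊗ₜ k₂) ⊗ₜ k₃))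
      = e k₂ • (π (St (ι k₁)) * coorbitBetaAux ι St e π U * π (ι k₃)) := by
  induction U with
  | zero => simp
  | add U V hU hV => simp only [add_mul, map_add, hU, hV, mul_add, smul_add]
  | tmul W h₃ =>
    induction W with
    | zero => simp
    | add U V hU hV =>
      simp only [TensorProduct.add_tmul, add_mul, map_add, hU, hV, mul_add, smul_add]
    | tmul h₁ h₂ =>
      simp only [Algebra.TensorProduct.tmul_mul_tmul, coorbitBetaAux_tmul, map_mul, hmul,
        mul_smul_comm, smul_mul_assoc, smul_smul, mul_assoc, mul_comm (e h₂)]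

lemma coorbitAlphaAux_tmul_mul (hmul : ∀ a b, St (a * b) = St b * St a)
    (U : (M ⊗[A] M) ⊗[A] M) (k₁ k₂ k₃ : M) :
    coorbitAlphaAux ι St e π (((k₁ ⊗ₜ k₂) ⊗ₜ k₃) * U)
      = e k₂ • (π (ι k₃) * coorbitAlphaAux ι St e π U * π (St (ι k₁))) := by
  induction U with
  | zero => simp
  | add U V hU hV => simp only [mul_add, map_add, hU, hV, add_mul, smul_add]
  | tmul W h₃ =>
    induction W with
    | zero => simp
    | add U V hU hV =>
      simp only [TensorProduct.add_tmul, mul_add, map_add, hU, hV, add_mul, smul_add]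
    | tmul h₁ h₂ =>
      simp only [Algebra.TensorProduct.tmul_mul_tmul, coorbitAlphaAux_tmul, map_mul, hmul,
        mul_smul_comm, smul_mul_assoc, smul_smul, mul_assoc]

end

section

variable {A R : Type} [CommRing A] [Ring R] [Algebra A R] {q : A} {a c : R}

lemma mul_pow_of_qComm (h : a * c = q • (c * a)) (n : ℕ) :
    a * c ^ n = q ^ n • (c ^ n * a) := by
  induction n with
  | zero => simp
  | succ n ih =>
    rw [pow_succ, ← mul_assoc, ih, smul_mul_assoc, mul_assoc, h, mul_smul_comm, smul_smul,
      ← pow_succ, mul_assoc]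

lemma pow_mul_of_qComm (h : a * c = q • (c * a)) (n : ℕ) :
    a ^ n * c = q ^ n • (c * a ^ n) := by
  induction n with
  | zero => simp
  | succ n ih =>
    rw [pow_succ', mul_assoc, ih, mul_smul_comm, ← mul_assoc, h, smul_mul_assoc, smul_smul,
      ← pow_succ, mul_assoc]

/-- The closed form of the sequence `p (n + 1) = -q ξ₁ c (p n) a + ξ₂ a (p n) c`. -/
lemma qComm_recursion_mul_right (h : a * c = q • (c * a)) (ξ₁ ξ₂ : A) (p : ℕ → R)
    (h0 : p 0 = 1)
    (hs : ∀ n, p (n + 1) = ξ₁ • ((-q) • c * p n * a) + ξ₂ • (a * p n * c)) (n : ℕ) :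
    p n = ((-q) ^ n * ∏ k ∈ Finset.range n, (ξ₁ - q ^ (2 * k) * ξ₂)) • (c ^ n * a ^ n) := by
  induction n with
  | zero => simp [h0]
  | succ n ih =>
    have h1 : c * (c ^ n * a ^ n) * a = c ^ (n + 1) * a ^ (n + 1) := by
      rw [pow_succ' c, pow_succ a]; simp only [mul_assoc]
    have h2 : a * (c ^ n * a ^ n) * c = q ^ (2 * n + 1) • (c ^ (n + 1) * a ^ (n + 1)) := by
      rw [← mul_assoc a, mul_pow_of_qComm h, smul_mul_assoc, smul_mul_assoc, mul_assoc (c ^ n),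
        ← pow_succ', mul_assoc, pow_mul_of_qComm h, mul_smul_comm, smul_smul, ← mul_assoc,
        ← pow_succ, ← pow_add]
      congr 2; ring
    rw [hs, ih]
    simp only [mul_smul_comm, smul_mul_assoc, h1, h2, smul_smul, ← add_smul,
      Finset.prod_range_succ]
    congr 1; ring

end

/-- The closed form of the sequence `p (n + 1) = -q ξ₁ a (p n) c + ξ₂ c (p n) a`. -/
lemma qComm_recursion_mul_left {K R : Type} [Field K] [Ring R] [Algebra K R] {q : K} {a c : R}
    (hq : q ≠ 0) (h : a * c = q • (c * a)) (ξ₁ ξ₂ : K) (p : ℕ → R) (h0 : p 0 = 1)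
    (hs : ∀ n, p (n + 1) = ξ₁ • (a * p n * ((-q) • c)) + ξ₂ • (c * p n * a)) (n : ℕ) :
    p n = ((-q) ^ n * ∏ k ∈ Finset.range n, (ξ₁ - (q ^ (2 * (k + 1)))⁻¹ * ξ₂)) •
      (a ^ n * c ^ n) := by
  have h' : c * a = q⁻¹ • (a * c) := by rw [h, smul_smul, inv_mul_cancel₀ hq, one_smul]
  induction n with
  | zero => simp [h0]
  | succ n ih =>
    have h1 : a * (a ^ n * c ^ n) * c = a ^ (n + 1) * c ^ (n + 1) := by
      rw [pow_succ' a, pow_succ c]; simp only [mul_assoc]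
    have h2 : c * (a ^ n * c ^ n) * a = q⁻¹ ^ (2 * n + 1) • (a ^ (n + 1) * c ^ (n + 1)) := by
      rw [← mul_assoc c, mul_pow_of_qComm h', smul_mul_assoc, smul_mul_assoc, mul_assoc (a ^ n),
        ← pow_succ', mul_assoc, pow_mul_of_qComm h', mul_smul_comm, smul_smul, ← mul_assoc,
        ← pow_succ, ← pow_add]
      congr 2; ring
    rw [hs, ih]
    simp only [mul_smul_comm, smul_mul_assoc, h1, h2, smul_smul, ← add_smul,
      Finset.prod_range_succ]
    have hinv : q⁻¹ ^ (2 * n + 1) = q * (q ^ (2 * (n + 1)))⁻¹ := by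
      rw [mul_add_one, pow_succ q (2 * n + 1), mul_inv_rev, ← mul_assoc, mul_inv_cancel₀ hq,
        one_mul, inv_pow]
    rw [hinv]
    congr 1; ring

/-- `N = 2`, `ξ = diag(ξ₁, ξ₂)`: explicit values of `ψ^ξ = π ∘ β^ξ` and
`φ^ξ = π ∘ α^ξ` on the powers of `x₂₁`. -/
theorem psi_phi_on_powers_of_x21
    (q : ℂ) (hq : q ≠ 0)
    (M G : Type) [Ring M] [Algebra ℂ M] [Ring G] [Algebra ℂ G]
    (x : Fin 2 → Fin 2 → M)
    (hrow : ∀ i j l : Fin 2, j < l → x i j * x i l = (q) • (x i l * x i j))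
    (hcol : ∀ i k j : Fin 2, i < k → x i j * x k j = (q) • (x k j * x i j))
    (hanti : ∀ i k j l : Fin 2, i < k → j < l → x i l * x k j = x k j * x i l)
    (hdiag : ∀ i k j l : Fin 2, i < k → j < l →
      x i j * x k l - x k l * x i j = ((q) - (q⁻¹)) • (x i l * x k j))
    (hgen : Algebra.adjoin ℂ (Set.range fun p : Fin 2 × Fin 2 => x p.1 p.2) = ⊤)
    (hfree : ∀ (B : Type) [Ring B] [Algebra ℂ B] (y : Fin 2 → Fin 2 → B),
      (∀ i j l : Fin 2, j < l → y i j * y i l = (q) • (y i l * y i j)) →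
      (∀ i k j : Fin 2, i < k → y i j * y k j = (q) • (y k j * y i j)) →
      (∀ i k j l : Fin 2, i < k → j < l → y i l * y k j = y k j * y i l) →
      (∀ i k j l : Fin 2, i < k → j < l →
        y i j * y k l - y k l * y i j = ((q) - (q⁻¹)) • (y i l * y k j)) →
      ∃! φ : M →ₐ[ℂ] B, ∀ i j, φ (x i j) = y i j)
    (ι : M →ₐ[ℂ] G) (dInv : G)
    (hd1 : ι (qdet (q) x) * dInv = 1)
    (hd2 : dInv * ι (qdet (q) x) = 1)
    (hgenG : Algebra.adjoin ℂ
      (Set.range (fun p : Fin 2 × Fin 2 => ι (x p.1 p.2)) ∪ {dInv}) = ⊤)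
    (hfreeG : ∀ (B : Type) [Ring B] [Algebra ℂ B] (φ : M →ₐ[ℂ] B) (u : B),
      φ (qdet (q) x) * u = 1 → u * φ (qdet (q) x) = 1 →
      ∃! ψ : G →ₐ[ℂ] B, ψ.comp ι = φ)
    (ΔM : M →ₐ[ℂ] M ⊗[ℂ] M)
    (hΔM : ∀ i j, ΔM (x i j) = ∑ k, x i k ⊗ₜ[ℂ] x k j)
    (ΔG : G →ₐ[ℂ] G ⊗[ℂ] G)
    (hΔG : ∀ m, ΔG (ι m) = Algebra.TensorProduct.map ι ι (ΔM m))
    (εG : G →ₐ[ℂ] ℂ)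
    (hεG : ∀ i j, εG (ι (x i j)) = if i = j then 1 else 0)
    (St : G →ₗ[ℂ] G)
    (hS1 : LinearMap.mul' ℂ G ∘ₗ TensorProduct.map St LinearMap.id ∘ₗ ΔG.toLinearMap
      = Algebra.linearMap ℂ G ∘ₗ εG.toLinearMap)
    (hS2 : LinearMap.mul' ℂ G ∘ₗ TensorProduct.map LinearMap.id St ∘ₗ ΔG.toLinearMap
      = Algebra.linearMap ℂ G ∘ₗ εG.toLinearMap)
    (SL : Type) [Ring SL] [Algebra ℂ SL] (π : G →ₐ[ℂ] SL)
    (hπsurj : Function.Surjective ⇑π)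
    (hπdet : π (ι (qdet q x)) = 1)
    (hfreeSL : ∀ (B : Type) [Ring B] [Algebra ℂ B] (φ : G →ₐ[ℂ] B),
      φ (ι (qdet q x)) = 1 → ∃! ψ : SL →ₐ[ℂ] B, ψ.comp π = φ)
    (ξ1 ξ2 : ℂ) (e : M →ₐ[ℂ] ℂ)
    (he00 : e (x 0 0) = ξ1) (he01 : e (x 0 1) = 0)
    (he10 : e (x 1 0) = 0) (he11 : e (x 1 1) = ξ2) :
    ∀ n : ℕ, 1 ≤ n →
      (π.toLinearMap ∘ₗ coorbit e (adjBeta ΔM ι St)) (x 1 0 ^ n)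
        = ((-q) ^ n * ∏ k ∈ Finset.range n, (ξ1 - q ^ (2 * k) * ξ2)) •
            (π (ι (x 1 0)) ^ n * π (ι (x 0 0)) ^ n)
      ∧ (π.toLinearMap ∘ₗ coorbit e (adjAlpha ΔM ι St)) (x 1 0 ^ n)
        = ((-q) ^ n * ∏ k ∈ Finset.range n, (ξ1 - (q ^ (2 * (k + 1)))⁻¹ * ξ2)) •
            (π (ι (x 0 0)) ^ n * π (ι (x 1 0)) ^ n) := by
  have homExt : ∀ (B : Type) [Ring B] [Algebra ℂ B] (f g : G →ₐ[ℂ] B),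
      (∀ i j, f (ι (x i j)) = g (ι (x i j))) → f = g := by
    intro B _ _ f g hfg
    have hcomp : g.comp ι = f.comp ι := by
      refine AlgHom.ext_of_adjoin_eq_top hgen ?_
      rintro _ ⟨p, rfl⟩
      exact (hfg p.1 p.2).symm
    refine (hfreeG B (f.comp ι) (f dInv) ?_ ?_).unique rfl hcomp
    · simp [← map_mul, hd1]
    · simp [← map_mul, hd2]
  have hΔ : ∀ i j, ΔG (ι (x i j)) = ∑ k, ι (x i k) ⊗ₜ[ℂ] ι (x k j) := by
    intro i j
    simp [hΔG, hΔM]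
  obtain ⟨hSt1, hSt⟩ := convInverse_mul_rev ΔG εG St
    (homExt _ _ _ fun i j => by
      simp [hΔ, TensorProduct.add_tmul, TensorProduct.tmul_add]; abel)
    (homExt _ _ _ fun i j => by fin_cases i <;> fin_cases j <;> simp [hΔ, hεG])
    (homExt _ _ _ fun i j => by fin_cases i <;> fin_cases j <;> simp [hΔ, hεG])
    hS1 hS2
  have hdet : π (ι (x 0 0)) * π (ι (x 1 1)) - q • (π (ι (x 0 1)) * π (ι (x 1 0))) = 1 := by
    simpa [qdet_fin_two] using hπdet
  have map_rel {u v : M} (h : u = v) : π (ι u) = π (ι v) := by rw [h]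
  have hac := map_rel (hcol 0 1 0 (by decide))
  have hcd := map_rel (hrow 1 0 1 (by decide))
  have hab := map_rel (hrow 0 0 1 (by decide))
  have hbc := map_rel (hanti 0 1 0 1 (by decide) (by decide))
  have hadj := map_rel (hdiag 0 1 0 1 (by decide) (by decide))
  have hT : ∀ i j, ∑ k, π (St (ι (x i k))) * π (ι (x k j)) = if i = j then 1 else 0 := by
    intro i j
    have h := congrArg π (LinearMap.congr_fun hS1 (ι (x i j)))
    simp only [LinearMap.comp_apply, AlgHom.toLinearMap_apply, hΔ, hεG] at h
    simpa [apply_ite π] using h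
  have hT10 := hT 1 0
  have hT11 := hT 1 1
  simp only [Fin.sum_univ_two, map_mul, map_smul, map_sub] at hac hcd hab hbc hadj hT10 hT11
  simp only [one_ne_zero, if_true, if_false] at hT10 hT11
  generalize ha : π (ι (x 0 0)) = a at *
  generalize hb : π (ι (x 0 1)) = b at *
  generalize hc : π (ι (x 1 0)) = c at *
  generalize hd : π (ι (x 1 1)) = d at *
  have hTc : π (St (ι (x 1 0))) = (-q) • c := by
    generalize π (St (ι (x 1 0))) = s at *
    generalize π (St (ι (x 1 1))) = t at *
    calc s = s * (a * d - q • (b * c)) := by rw [hdet, mul_one]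
      _ = (s * a + t * c) * d - q • ((s * b + t * d) * c) - t * (c * d - q • (d * c)) := by
        simp only [mul_sub, add_mul, mul_smul_comm, smul_add, mul_assoc]; abel
      _ = (-q) • c := by rw [hT10, hT11, hcd]; simp
  have hTd : π (St (ι (x 1 1))) = a := by
    generalize π (St (ι (x 1 0))) = s at *
    generalize π (St (ι (x 1 1))) = t at *
    have hdet' : d * a - q⁻¹ • (c * b) = 1 := by
      rw [← hdet, ← hbc, ← sub_eq_zero]
      have : d * a = a * d - (q - q⁻¹) • (b * c) := by rw [← hadj]; abel
      rw [this, sub_smul]; abel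
    have hba : b * a = q⁻¹ • (a * b) := by rw [hab, smul_smul, inv_mul_cancel₀ hq, one_smul]
    calc t = t * (d * a - q⁻¹ • (c * b)) := by rw [hdet', mul_one]
      _ = (s * b + t * d) * a - q⁻¹ • ((s * a + t * c) * b)
          - s * (b * a - q⁻¹ • (a * b)) := by
        simp only [mul_sub, add_mul, mul_smul_comm, smul_add, mul_assoc]; abel
      _ = a := by rw [hT10, hT11, hba]; simp
  let D : M →ₐ[ℂ] (M ⊗[ℂ] M) ⊗[ℂ] M := (Algebra.TensorProduct.map ΔM (.id ℂ M)).comp ΔM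
  have hD : D (x 1 0) = ∑ k, ∑ j, (x 1 j ⊗ₜ[ℂ] x j k) ⊗ₜ[ℂ] x k 0 := by
    simp [D, hΔM, TensorProduct.add_tmul]
  have hψ : ∀ m, (π.toLinearMap ∘ₗ coorbit e (adjBeta ΔM ι St)) m
      = coorbitBetaAux ι St e π (D m) := fun m => rfl
  have hφ : ∀ m, (π.toLinearMap ∘ₗ coorbit e (adjAlpha ΔM ι St)) m
      = coorbitAlphaAux ι St e π (D m) := fun m => rfl
  intro n _
  constructor
  · refine qComm_recursion_mul_right hac ξ1 ξ2
      (fun n => (π.toLinearMap ∘ₗ coorbit e (adjBeta ΔM ι St)) (x 1 0 ^ n)) ?_ ?_ n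
    · simp [hψ, Algebra.TensorProduct.one_def, coorbitBetaAux_tmul, hSt1]
    · intro n
      simp only [hψ, pow_succ, map_mul, hD]
      simp only [Fin.sum_univ_two, mul_add, map_add, coorbitBetaAux_mul_tmul ι St e π hSt,
        he00, he01, he10, he11, ha, hc, hTc, hTd, zero_smul, add_zero, zero_add]
  · refine qComm_recursion_mul_left hq hac ξ1 ξ2
      (fun n => (π.toLinearMap ∘ₗ coorbit e (adjAlpha ΔM ι St)) (x 1 0 ^ n)) ?_ ?_ n
    · simp [hφ, Algebra.TensorProduct.one_def, coorbitAlphaAux_tmul, hSt1]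
    · intro n
      simp only [hφ, pow_succ', map_mul, hD]
      simp only [Fin.sum_univ_two, add_mul, map_add, coorbitAlphaAux_tmul_mul ι St e π hSt,
        he00, he01, he10, he11, ha, hc, hTc, hTd, zero_smul, add_zero, zero_add]
end
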